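/- Let G be a finite simple graph of order n, and let a, b, m, Δ be non-negative integers with b − Δ ≥ a ≥ 2, δ(G) ≥ (a+Δ)n/(b+2a+Δ) + b(b−Δ)/(a+Δ) + m, and n > (a+b+2m−1)(b+2a+Δ)/(a+Δ). Let g, f be integer-valued functions on V(G) with a ≤ g(x) ≤ f(x) − Δ ≤ b − Δ for every vertex x. If for every pair of distinct non-adjacent vertices x, y of G we have max{d_G(x), d_G(y)} ≥ (a+b)n/(b+2a+Δ), then G is a fractional ID-(g,f,m)-deleted graph. -/

import Mathlib

open Classical Finset

/-- The fractional degree `d_G^h(x)` of a vertex: the sum of `h e` over all edges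
(unordered pairs) containing `x`. -/
noncomputable def fracDeg {V : Type*} [Fintype V] [DecidableEq V]
    (h : Sym2 V → ℝ) (x : V) : ℝ :=
  ∑ e ∈ Finset.univ.filter (fun e : Sym2 V => x ∈ e), h e

/-- `G` admits a fractional `(g,f)`-factor: a weighting `h : E(G) → [0,1]`
(extended by `0` off the edge set) with `g x ≤ d_G^h(x) ≤ f x` for every vertex. -/
def HasFracFactor {V : Type*} [Fintype V] [DecidableEq V]
    (G : SimpleGraph V) (g f : V → ℤ) : Prop :=
  ∃ h : Sym2 V → ℝ,
    (∀ e, 0 ≤ h e ∧ h e ≤ 1) ∧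
    (∀ e, e ∉ G.edgeSet → h e = 0) ∧
    (∀ x : V, (g x : ℝ) ≤ fracDeg h x ∧ fracDeg h x ≤ (f x : ℝ))

/-- `G` is a fractional `(g,f,m)`-deleted graph: after deleting any `m` edges,
the resulting graph admits a fractional `(g,f)`-factor. -/
def FracDeleted {V : Type*} [Fintype V] [DecidableEq V]
    (G : SimpleGraph V) (g f : V → ℤ) (m : ℕ) : Prop :=
  ∀ H : Finset (Sym2 V), ↑H ⊆ G.edgeSet → H.card = m →
    HasFracFactor (G.deleteEdges ↑H) g f

/-- `G` is a fractional `(g,f,n',m)`-critical deleted graph: after deleting any `n'`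
vertices, the resulting induced graph is a fractional `(g,f,m)`-deleted graph. -/
def FracCriticalDeleted {V : Type*} [Fintype V] [DecidableEq V]
    (G : SimpleGraph V) (g f : V → ℤ) (n' m : ℕ) : Prop :=
  ∀ U : Finset V, U.card = n' →
    FracDeleted (G.induce ((↑U : Set V)ᶜ)) (fun x => g x.1) (fun x => f x.1) m

/-- `G` is a fractional ID-`(g,f,m)`-deleted graph: after deleting any independent set
of vertices, the resulting induced graph is a fractional `(g,f,m)`-deleted graph. -/
def FracIDDeleted {V : Type*} [Fintype V] [DecidableEq V]
    (G : SimpleGraph V) (g f : V → ℤ) (m : ℕ) : Prop :=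
  ∀ I : Set V, (∀ u ∈ I, ∀ v ∈ I, ¬ G.Adj u v) →
    FracDeleted (G.induce Iᶜ) (fun x => g x.1) (fun x => f x.1) m

theorem fracDeg_eq_sum {V : Type*} [Fintype V] [DecidableEq V] (h : Sym2 V → ℝ) (x : V) :
    fracDeg h x = ∑ y, h s(x, y) := by
  unfold fracDeg
  refine (Finset.sum_bij (fun y _ => s(x, y)) ?_ ?_ ?_ ?_).symm
  · intro y _
    simp
  · intro y _ z _ hyz
    exact Sym2.congr_right.1 hyz
  · intro e he
    obtain ⟨y, rfl⟩ := Sym2.mem_iff_exists.1 (Finset.mem_filter.1 he).2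
    exact ⟨y, Finset.mem_univ _, rfl⟩
  · intro y _
    rfl

/-- The signed distance of `t` from the interval `[l, u]`. -/
noncomputable def intervalDev (l u t : ℝ) : ℝ := max (t - u) 0 - max (l - t) 0

theorem intervalDev_add_sq_le {l u : ℝ} (hlu : l ≤ u) (t ε : ℝ) :
    intervalDev l u (t + ε) ^ 2 ≤ (intervalDev l u t + ε) ^ 2 := by
  apply sq_le_sq.2
  unfold intervalDev
  rcases max_cases (t - u) 0 with h1 | h1 <;> rcases max_cases (l - t) 0 with h2 | h2 <;>
  rcases max_cases (t + ε - u) 0 with h3 | h3 <;> rcases max_cases (l - (t + ε)) 0 with h4 | h4 <;>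
  rcases abs_cases (max (t + ε - u) 0 - max (l - (t + ε)) 0) with h5 | h5 <;>
  rcases abs_cases (max (t - u) 0 - max (l - t) 0 + ε) with h6 | h6 <;>
  linarith

theorem fracDeg_update_add {V : Type*} [Fintype V] [DecidableEq V] (h : Sym2 V → ℝ)
    (e : Sym2 V) (ε : ℝ) (z : V) :
    fracDeg (Function.update h e (h e + ε)) z = fracDeg h z + if z ∈ e then ε else 0 := by
  have hfun : Function.update h e (h e + ε) = fun e' => h e' + if e' = e then ε else 0 := by
    funext e'
    by_cases he : e' = e
    · subst he; simp
    · simp [he]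
  unfold fracDeg
  rw [hfun, Finset.sum_add_distrib]
  congr 1
  simp [Finset.sum_ite_eq']

theorem sum_mem_pair {V : Type*} [Fintype V] [DecidableEq V] {x y : V} (hxy : x ≠ y)
    (F G : V → ℝ) :
    ∑ z, (if z ∈ s(x, y) then F z else G z) = ∑ z, G z + (F x - G x) + (F y - G y) := by
  have : ∀ z, (if z ∈ s(x, y) then F z else G z) =
      G z + (if z = x then F z - G z else 0) + (if z = y then F z - G z else 0) := by
    intro z
    by_cases h1 : z = x
    · subst h1; simp [hxy]
    · by_cases h2 : z = y
      · subst h2; simp [h1]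
      · simp [h1, h2]
  rw [Finset.sum_congr rfl fun z _ => this z]
  simp [Finset.sum_add_distrib]

/-- There is a weighting such that an edge with positive total signed distance at its ends has
weight `0`, and one with negative total has weight `1`. -/
theorem exists_weighting_complementary {V : Type*} [Fintype V] [DecidableEq V]
    (G : SimpleGraph V) (l u : V → ℝ) (hlu : ∀ x, l x ≤ u x) :
    ∃ h : Sym2 V → ℝ, (∀ e, 0 ≤ h e ∧ h e ≤ 1) ∧ (∀ e, e ∉ G.edgeSet → h e = 0) ∧
      ∀ x y, G.Adj x y →
        (0 < intervalDev (l x) (u x) (fracDeg h x) + intervalDev (l y) (u y) (fracDeg h y) →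
          h s(x, y) = 0) ∧
        (intervalDev (l x) (u x) (fracDeg h x) + intervalDev (l y) (u y) (fracDeg h y) < 0 →
          h s(x, y) = 1) := by
  let K : Set (Sym2 V → ℝ) :=
    Set.univ.pi fun e => Set.Icc 0 (if e ∈ G.edgeSet then 1 else 0)
  let Φ : (Sym2 V → ℝ) → ℝ := fun h => ∑ x, intervalDev (l x) (u x) (fracDeg h x) ^ 2
  have hK : IsCompact K := isCompact_univ_pi fun e => isCompact_Icc
  have hne : K.Nonempty := ⟨0, fun e _ => ⟨le_rfl, by simp only [Pi.zero_apply]; split_ifs <;> simp⟩⟩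
  have hΦ : Continuous Φ := by
    unfold Φ intervalDev fracDeg
    fun_prop
  obtain ⟨h, hh, hmin⟩ := hK.exists_isMinOn hne hΦ.continuousOn
  have hstep : ∀ x y, G.Adj x y → ∀ ε, 0 ≤ h s(x, y) + ε → h s(x, y) + ε ≤ 1 →
      0 ≤ ε * (intervalDev (l x) (u x) (fracDeg h x) +
        intervalDev (l y) (u y) (fracDeg h y) + ε) := by
    intro x y hxy ε h0 h1
    have hmem : Function.update h s(x, y) (h s(x, y) + ε) ∈ K := by
      intro e _
      by_cases he : e = s(x, y)
      · subst he
        simpa [hxy] using ⟨h0, h1⟩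
      · simpa [he] using hh e (Set.mem_univ e)
    have hle : Φ h ≤ Φ (Function.update h s(x, y) (h s(x, y) + ε)) := hmin hmem
    have hle2 : Φ (Function.update h s(x, y) (h s(x, y) + ε)) ≤
        ∑ z, if z ∈ s(x, y) then (intervalDev (l z) (u z) (fracDeg h z) + ε) ^ 2
          else intervalDev (l z) (u z) (fracDeg h z) ^ 2 := by
      refine Finset.sum_le_sum fun z _ => ?_
      rw [fracDeg_update_add]
      split_ifs
      · exact intervalDev_add_sq_le (hlu z) _ _
      · simp
    rw [sum_mem_pair hxy.ne] at hle2
    have := hle.trans hle2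
    simp only [Φ] at this
    nlinarith
  have hb : ∀ e, 0 ≤ h e ∧ h e ≤ 1 := fun e => by
    have := hh e (Set.mem_univ e)
    refine ⟨this.1, this.2.trans ?_⟩
    split_ifs <;> simp
  refine ⟨h, hb, fun e he => ?_, fun x y hxy => ⟨fun hc => ?_, fun hc => ?_⟩⟩
  · have := hh e (Set.mem_univ e)
    simp only [he, if_false] at this
    exact le_antisymm this.2 this.1
  · by_contra hne0
    have hpos : 0 < h s(x, y) := lt_of_le_of_ne (hb _).1 (Ne.symm hne0)
    set c := intervalDev (l x) (u x) (fracDeg h x) + intervalDev (l y) (u y) (fracDeg h y)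
    have hε : 0 < min (h s(x, y)) (c / 2) := lt_min hpos (by linarith)
    have hε1 := min_le_left (h s(x, y)) (c / 2)
    have hε2 := min_le_right (h s(x, y)) (c / 2)
    have := hstep x y hxy (-min (h s(x, y)) (c / 2)) (by linarith) (by linarith [(hb s(x, y)).2])
    nlinarith
  · by_contra hne1
    have hpos : h s(x, y) < 1 := lt_of_le_of_ne (hb _).2 hne1
    set c := intervalDev (l x) (u x) (fracDeg h x) + intervalDev (l y) (u y) (fracDeg h y)
    have hε : 0 < min (1 - h s(x, y)) (-c / 2) := lt_min (by linarith) (by linarith)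
    have hε1 := min_le_left (1 - h s(x, y)) (-c / 2)
    have hε2 := min_le_right (1 - h s(x, y)) (-c / 2)
    have := hstep x y hxy (min (1 - h s(x, y)) (-c / 2)) (by linarith [(hb s(x, y)).1])
      (by linarith)
    nlinarith

/-- A weighted bound on `#T` from degree-type data: `L` marks the low-degree members of `T`, which
form a clique, `d t` counts neighbours after deletion and `η t` the deleted edges at `t`. -/
theorem card_mul_le_of_local_bounds {ι : Type*} (T : Finset ι) (d η : ι → ℕ) (L : ι → Prop)
    (p q b m s i : ℕ) (N : ℝ) (hp : 2 ≤ p) (hpb : p ≤ b) (hqb : q ≤ b)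
    (hN : (p : ℝ) + q + 2 * m - 1 < p * N) (hi : (i : ℝ) ≤ p * N)
    (hcard : (s : ℝ) + #T + i ≤ (2 * p + q) * N)
    (hd : ∀ t ∈ T, d t < q) (hη : ∀ t ∈ T, η t ≤ m) (hηsum : ∑ t ∈ T, η t ≤ 2 * m)
    (hmin : ∀ t ∈ T, b * q + p * m ≤ p * (s + d t + η t))
    (hhigh : ∀ t ∈ T, ¬ L t → ((p : ℝ) + q) * N ≤ i + s + d t + η t)
    (hclique : ∀ t ∈ T, L t → #(T.filter L) ≤ d t + η t + 1) :
    q * #T ≤ p * s + ∑ t ∈ T, d t := by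
  have hsum : ∑ t ∈ T, (d t + η t) ≤ ∑ t ∈ T, d t + 2 * m := by
    rw [Finset.sum_add_distrib]; omega
  rcases T.eq_empty_or_nonempty with rfl | hT
  · simp
  have hk : 0 < #T := hT.card_pos
  by_cases hall : ∀ t ∈ T, q ≤ d t + η t
  · -- averaging the minimum degree bound over `T`
    have h1 : #T * q ≤ ∑ t ∈ T, (d t + η t) := by
      simpa using Finset.card_nsmul_le_sum T _ q hall
    have h2 : ∑ t ∈ T, d t ≤ #T * q := by
      simpa using Finset.sum_le_card_nsmul T d q fun t ht => (hd t ht).le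
    have h3 : ∑ t ∈ T, η t ≤ #T * m := by
      simpa using Finset.sum_le_card_nsmul T η m hη
    have h4 : #T * (b * q + p * m) ≤ p * (#T * s + ∑ t ∈ T, (d t + η t)) := by
      have := Finset.card_nsmul_le_sum T _ _ hmin
      rw [← Finset.mul_sum] at this
      simpa [add_assoc, Finset.sum_add_distrib] using this
    rw [Finset.sum_add_distrib] at h1 h4
    generalize #T = k at *
    generalize ∑ t ∈ T, d t = E at *
    generalize ∑ t ∈ T, η t = F at *
    zify at *
    have hw : 0 ≤ (k : ℤ) * q - E := by linarith
    have hbE : 0 ≤ ((b : ℤ) - p) * E := mul_nonneg (by linarith) (by positivity)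
    have key : 0 ≤ ((k : ℤ) * q - E) * (b - k) + p * ((k : ℤ) * m - F) := by
      have hF : 0 ≤ (k : ℤ) * m - F := by linarith
      rcases le_total (k : ℤ) b with hkb | hkb
      · have := mul_nonneg hw (sub_nonneg.2 hkb)
        positivity
      · nlinarith [mul_nonneg (show 0 ≤ 2 * (m : ℤ) - ((k : ℤ) * q - E) by linarith) (sub_nonneg.2 hkb),
          mul_nonneg (show 0 ≤ (p : ℤ) - 2 by linarith) hF,
          mul_nonneg (show 0 ≤ (m : ℤ) by positivity) (show 0 ≤ (b : ℤ) - 2 by linarith)]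
    have : 0 ≤ (k : ℤ) * (p * s + E - q * k) := by nlinarith
    have := nonneg_of_mul_nonneg_right this hk
    linarith
  push Not at hall
  by_cases hex : ∃ t ∈ T, ¬ L t ∧ d t + η t < q
  · obtain ⟨t, ht, htL, htq⟩ := hex
    obtain ⟨t₁, ht₁, hmin₁⟩ := Finset.exists_min_image (T.filter fun t => ¬ L t)
      (fun t => d t + η t) ⟨t, Finset.mem_filter.2 ⟨ht, htL⟩⟩
    have ht₁' := Finset.mem_filter.1 ht₁
    have he₁ : d t₁ + η t₁ < q := (hmin₁ t (Finset.mem_filter.2 ⟨ht, htL⟩)).trans_lt htq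
    have hS := hhigh t₁ ht₁'.1 ht₁'.2
    obtain ⟨e₀, he₀, hbound⟩ : ∃ e₀ ≤ d t₁ + η t₁, (d t₁ + η t₁) * #T ≤
        ∑ t ∈ T, (d t + η t) + (d t₁ + η t₁ - e₀) * (e₀ + 1) := by
      by_cases hlow : ∃ t ∈ T, L t ∧ d t + η t < d t₁ + η t₁
      · obtain ⟨u, hu, huL, hue⟩ := hlow
        obtain ⟨t₀, ht₀, hmin₀⟩ := Finset.exists_min_image (T.filter L)
          (fun t => d t + η t) ⟨u, Finset.mem_filter.2 ⟨hu, huL⟩⟩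
        have ht₀' := Finset.mem_filter.1 ht₀
        have hle : d t₀ + η t₀ ≤ d t₁ + η t₁ :=
          ((hmin₀ u (Finset.mem_filter.2 ⟨hu, huL⟩)).trans_lt hue).le
        refine ⟨d t₀ + η t₀, hle, ?_⟩
        have h1 : #(T.filter L) * (d t₀ + η t₀) ≤ ∑ t ∈ T.filter L, (d t + η t) := by
          simpa using Finset.card_nsmul_le_sum _ _ _ hmin₀
        have h2 : #(T.filter fun t => ¬ L t) * (d t₁ + η t₁) ≤
            ∑ t ∈ T with ¬ L t, (d t + η t) := by
          simpa using Finset.card_nsmul_le_sum _ _ _ hmin₁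
        have h3 := Finset.sum_filter_add_sum_filter_not T L (fun t => d t + η t)
        have h4 := Finset.card_filter_add_card_filter_not (s := T) L
        have h5 := hclique t₀ ht₀'.1 ht₀'.2
        obtain ⟨j, hj⟩ := Nat.exists_eq_add_of_le hle
        rw [← h3, ← h4, hj, Nat.add_sub_cancel_left]
        rw [hj] at h2
        nlinarith [Nat.mul_le_mul_left j h5]
      · push Not at hlow
        refine ⟨_, le_rfl, ?_⟩
        have : #T * (d t₁ + η t₁) ≤ ∑ t ∈ T, (d t + η t) := by
          simpa using Finset.card_nsmul_le_sum T (fun t => d t + η t) (d t₁ + η t₁) fun t ht => by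
            by_cases hLt : L t
            · exact hlow t ht hLt
            · exact hmin₁ t (Finset.mem_filter.2 ⟨ht, hLt⟩)
        simpa [mul_comm] using this
    replace hbound := hbound.trans (Nat.add_le_add_right hsum _)
    rw [add_assoc _ (d t₁ : ℝ), ← Nat.cast_add (d t₁)] at hS
    generalize d t₁ + η t₁ = e at *
    generalize ∑ t ∈ T, d t = E at *
    generalize #T = k at *
    have hqe : (0 : ℝ) ≤ q - e := sub_nonneg.2 (by exact_mod_cast he₁.le)
    rcases Nat.eq_zero_or_pos e with rfl | hepos
    · have : (q : ℝ) * k ≤ p * s := by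
        push_cast at hS
        nlinarith [mul_nonneg hqe (sub_nonneg.2 hcard), mul_nonneg (show 0 ≤ (p : ℝ) by positivity)
          (sub_nonneg.2 hi), mul_nonneg (show 0 ≤ (p : ℝ) + q by positivity) (sub_nonneg.2 hS)]
      have : q * k ≤ p * s := by exact_mod_cast this
      omega
    · obtain ⟨j, rfl⟩ := Nat.exists_eq_add_of_le he₀
      rw [Nat.add_sub_cancel_left] at hbound
      have hquad : (-1 : ℤ) ≤ ((e₀ : ℤ) + j) * (e₀ + j - 1) - j * (e₀ + 1) := by
        have hj : (j : ℤ) * (j - 1) ≥ 0 := by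
          rcases Nat.eq_zero_or_pos j with rfl | hj
          · simp
          · exact mul_nonneg (by positivity) (by omega)
        rcases Nat.eq_zero_or_pos e₀ with rfl | h0
        · push_cast
          nlinarith [sq_nonneg ((j : ℤ) - 1)]
        · have h1 : (0 : ℤ) ≤ e₀ - 1 := by omega
          nlinarith [mul_nonneg h1 (Int.natCast_nonneg e₀), mul_nonneg h1 (Int.natCast_nonneg j)]
      have hquad' : (-1 : ℝ) ≤ ((e₀ : ℝ) + j) * (e₀ + j - 1) - j * (e₀ + 1) := by
        exact_mod_cast hquad
      have hbound' : ((e₀ : ℝ) + j) * k ≤ E + 2 * m + j * (e₀ + 1) := by exact_mod_cast hbound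
      have he1 : (1 : ℝ) ≤ e₀ + j := by exact_mod_cast hepos
      push_cast at hS hqe
      have hlt : (q : ℝ) * k < p * s + E + 1 := by
        set e : ℝ := e₀ + j
        have a1 := mul_nonneg hqe (sub_nonneg.2 hcard)
        have a2 := mul_nonneg (show 0 ≤ (p : ℝ) by positivity) (sub_nonneg.2 hi)
        have a3 := mul_nonneg (show 0 ≤ (p : ℝ) + (q - e) by positivity) (sub_nonneg.2 hS)
        have a4 := mul_pos (show (0 : ℝ) < e by linarith) (sub_pos.2 hN)
        have a5 := mul_nonneg (show 0 ≤ (m : ℝ) by positivity) (sub_nonneg.2 he1)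
        nlinarith
      have hlt' : q * k < p * s + E + 1 := by exact_mod_cast hlt
      omega
  · push Not at hex
    have hTL : (T.filter L).Nonempty := by
      obtain ⟨t, ht, htq⟩ := hall
      refine ⟨t, Finset.mem_filter.2 ⟨ht, ?_⟩⟩
      by_contra hLt
      exact absurd (hex t ht hLt) (by omega)
    obtain ⟨t₀, ht₀, hmin₀⟩ := Finset.exists_min_image _ (fun t => d t + η t) hTL
    have ht₀' := Finset.mem_filter.1 ht₀
    have he₀ : d t₀ + η t₀ < q := by
      obtain ⟨t, ht, htq⟩ := hall
      by_cases hLt : L t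
      · exact (hmin₀ t (Finset.mem_filter.2 ⟨ht, hLt⟩)).trans_lt htq
      · exact absurd (hex t ht hLt) (by omega)
    have h1 : #(T.filter L) * (d t₀ + η t₀) ≤ ∑ t ∈ T.filter L, (d t + η t) := by
      simpa using Finset.card_nsmul_le_sum _ _ _ hmin₀
    have h2 : #(T.filter fun t => ¬ L t) * q ≤ ∑ t ∈ T with ¬ L t, (d t + η t) := by
      have := Finset.card_nsmul_le_sum (T.filter fun t => ¬ L t) (fun t => d t + η t) q
        fun t ht => hex t (Finset.mem_filter.1 ht).1 (Finset.mem_filter.1 ht).2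
      simpa using this
    have h3 := Finset.sum_filter_add_sum_filter_not T L (fun t => d t + η t)
    have h4 := Finset.card_filter_add_card_filter_not (s := T) L
    have h5 := hclique t₀ ht₀'.1 ht₀'.2
    have h6 := hmin t₀ ht₀'.1
    rw [add_assoc] at h6
    rw [← h4]
    generalize d t₀ + η t₀ = e at *
    generalize #(T.filter L) = k₁ at *
    generalize #(T.filter fun t => ¬ L t) = k₂ at *
    generalize ∑ t ∈ T, d t = E at *
    zify at *
    nlinarith [mul_nonneg (show 0 ≤ (q : ℤ) - e by linarith) (show 0 ≤ (e : ℤ) + 1 - k₁ by linarith),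
      mul_nonneg (show 0 ≤ (q : ℤ) - e by linarith) (show 0 ≤ (b : ℤ) - e - 1 by linarith),
      mul_nonneg (show 0 ≤ (b : ℤ) - p by linarith) (show 0 ≤ (e : ℤ) by positivity),
      mul_nonneg (show 0 ≤ (p : ℤ) - 2 by linarith) (show 0 ≤ (m : ℤ) by positivity)]

theorem eq_left_add_intervalDev {l u t : ℝ} (hlu : l ≤ u) (h : intervalDev l u t < 0) :
    t = l + intervalDev l u t := by
  unfold intervalDev at *
  rcases max_cases (t - u) 0 with h1 | h1 <;> rcases max_cases (l - t) 0 with h2 | h2 <;> linarith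

theorem eq_right_add_intervalDev {l u t : ℝ} (hlu : l ≤ u) (h : 0 < intervalDev l u t) :
    t = u + intervalDev l u t := by
  unfold intervalDev at *
  rcases max_cases (t - u) 0 with h1 | h1 <;> rcases max_cases (l - t) 0 with h2 | h2 <;> linarith

theorem mem_Icc_of_intervalDev_eq_zero {l u t : ℝ} (hlu : l ≤ u) (h : intervalDev l u t = 0) :
    l ≤ t ∧ t ≤ u := by
  unfold intervalDev at *
  rcases max_cases (t - u) 0 with h1 | h1 <;> rcases max_cases (l - t) 0 with h2 | h2 <;>
  constructor <;> linarith

/-- The number of neighbours of `t` outside `S`. -/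
noncomputable def degreeOutside {V : Type*} [Fintype V] (G : SimpleGraph V) (S : Finset V)
    (t : V) : ℕ :=
  #{w | G.Adj t w ∧ w ∉ S}

theorem card_filter_adj_notMem {V : Type*} [Fintype V] (G : SimpleGraph V) (S : Finset V) (t : V)
    [DecidablePred fun w => G.Adj t w ∧ w ∉ S] :
    #{w | G.Adj t w ∧ w ∉ S} = degreeOutside G S t := by
  unfold degreeOutside
  congr!

/-- The sufficiency part of Anstee's criterion for fractional `(g,f)`-factors. -/
theorem hasFracFactor_of_cut {V : Type*} [Fintype V] [DecidableEq V] (G : SimpleGraph V)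
    (g f : V → ℤ) (hgf : ∀ x, g x ≤ f x)
    (hcut : ∀ S T : Finset V, Disjoint S T →
      (∀ t ∈ T, (degreeOutside G S t : ℤ) < g t) →
      ∑ t ∈ T, g t ≤ ∑ s ∈ S, f s + ∑ t ∈ T, (degreeOutside G S t : ℤ)) :
    HasFracFactor G g f := by
  have hcut' : ∀ S T : Finset V, Disjoint S T →
      ∑ t ∈ T, g t ≤ ∑ s ∈ S, f s + ∑ t ∈ T, (degreeOutside G S t : ℤ) := by
    intro S T hST
    have h1 := hcut S (T.filter fun t => (degreeOutside G S t : ℤ) < g t)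
      (hST.mono_right (Finset.filter_subset _ _)) fun t ht => (Finset.mem_filter.1 ht).2
    have h2 : ∑ t ∈ T with ¬ (degreeOutside G S t : ℤ) < g t, g t ≤
        ∑ t ∈ T with ¬ (degreeOutside G S t : ℤ) < g t, (degreeOutside G S t : ℤ) :=
      Finset.sum_le_sum fun t ht => not_lt.1 (Finset.mem_filter.1 ht).2
    rw [← Finset.sum_filter_add_sum_filter_not T
      (fun t => (degreeOutside G S t : ℤ) < g t) g,
      ← Finset.sum_filter_add_sum_filter_not T
      (fun t => (degreeOutside G S t : ℤ) < g t) fun t => (degreeOutside G S t : ℤ)]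
    linarith
  have hgf' : ∀ x, (g x : ℝ) ≤ f x := fun x => by exact_mod_cast hgf x
  obtain ⟨h, h01, hoff, hcomp⟩ :=
    exists_weighting_complementary G (fun x => (g x : ℝ)) (fun x => (f x : ℝ)) hgf'
  set y : V → ℝ := fun x => intervalDev (g x) (f x) (fracDeg h x) with hy
  refine ⟨h, h01, hoff, fun x => ?_⟩
  by_cases hall : ∀ x, y x = 0
  · exact mem_Icc_of_intervalDev_eq_zero (hgf' x) (hall x)
  exfalso
  push Not at hall
  obtain ⟨x₀, hx₀⟩ := hall
  obtain ⟨x₁, -, hmax⟩ := Finset.exists_max_image Finset.univ (fun x => |y x|) ⟨x₀, mem_univ _⟩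
  set μ := |y x₁| with hμ
  have hμpos : 0 < μ := (abs_pos.2 hx₀).trans_le (hmax x₀ (mem_univ _))
  have hle : ∀ x, -μ ≤ y x ∧ y x ≤ μ := fun x => abs_le.1 (hmax x (mem_univ _))
  set S : Finset V := Finset.univ.filter fun x => y x = μ with hS
  set T : Finset V := Finset.univ.filter fun x => y x = -μ with hT
  have memS : ∀ x, x ∈ S ↔ y x = μ := fun x => by simp [hS]
  have memT : ∀ x, x ∈ T ↔ y x = -μ := fun x => by simp [hT]
  have hST : Disjoint S T := Finset.disjoint_left.2 fun x h1 h2 => by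
    rw [memS] at h1; rw [memT] at h2; linarith
  have hnonempty : 0 < #S + #T := by
    rcases abs_choice (y x₁) with h1 | h1
    · have : 0 < #S := Finset.card_pos.2 ⟨x₁, (memS _).2 (by rw [hμ, h1])⟩
      omega
    · have : 0 < #T := Finset.card_pos.2 ⟨x₁, (memT _).2 (by rw [hμ, h1, neg_neg])⟩
      omega
  have hone : ∀ t ∈ T, ∀ w ∉ S, h s(t, w) = if G.Adj t w then 1 else 0 := by
    intro t ht w hw
    split_ifs with hadj
    · refine (hcomp t w hadj).2 ?_
      have h1 := (memT t).1 ht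
      have h2 := lt_of_le_of_ne (hle w).2 fun h => hw ((memS w).2 h)
      simp only [hy] at h1 h2
      linarith
    · exact hoff _ hadj
  have hzero : ∀ s ∈ S, ∀ w ∉ T, h s(s, w) = 0 := by
    intro s hs w hw
    by_cases hadj : G.Adj s w
    · refine (hcomp s w hadj).1 ?_
      have h1 := (memS s).1 hs
      have h2 := lt_of_le_of_ne (hle w).1 fun h => hw ((memT w).2 h.symm)
      simp only [hy] at h1 h2
      linarith
    · exact hoff _ hadj
  have hdegT : ∀ t ∈ T, fracDeg h t = degreeOutside G S t + ∑ w ∈ S, h s(t, w) := by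
    intro t ht
    rw [fracDeg_eq_sum, ← Finset.sum_filter_add_sum_filter_not univ (fun w => w ∉ S)]
    congr 1
    · rw [Finset.sum_congr rfl fun w hw => hone t ht w (Finset.mem_filter.1 hw).2,
        ← Finset.sum_filter, Finset.filter_filter, ← card_filter_adj_notMem]
      simp [and_comm]
    · simp
  have hdegS : ∀ s ∈ S, fracDeg h s = ∑ w ∈ T, h s(s, w) := by
    intro s hs
    rw [fracDeg_eq_sum]
    exact (Finset.sum_subset (Finset.subset_univ T) fun w _ hw => hzero s hs w hw).symm
  have hT1 : ∑ t ∈ T, fracDeg h t = ∑ t ∈ T, (g t : ℝ) - #T * μ := by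
    rw [Finset.sum_congr rfl fun t ht => eq_left_add_intervalDev (hgf' t)
      (show y t < 0 by rw [(memT t).1 ht]; linarith), Finset.sum_add_distrib,
      Finset.sum_congr (f := fun x => intervalDev _ _ _) rfl fun t ht => (memT t).1 ht]
    simp [sub_eq_add_neg]
  have hS1 : ∑ s ∈ S, fracDeg h s = ∑ s ∈ S, (f s : ℝ) + #S * μ := by
    rw [Finset.sum_congr rfl fun t ht => eq_right_add_intervalDev (hgf' t)
      (show 0 < y t by rw [(memS t).1 ht]; linarith), Finset.sum_add_distrib,
      Finset.sum_congr (f := fun x => intervalDev _ _ _) rfl fun t ht => (memS t).1 ht]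
    simp
  rw [Finset.sum_congr rfl hdegT, Finset.sum_add_distrib] at hT1
  rw [Finset.sum_congr rfl hdegS, Finset.sum_comm] at hS1
  simp only [Sym2.eq_swap] at hT1 hS1
  have hc : ∑ t ∈ T, (g t : ℝ) ≤ ∑ s ∈ S, (f s : ℝ) + ∑ t ∈ T, (degreeOutside G S t : ℝ) := by
    exact_mod_cast hcut' S T hST
  have : (0 : ℝ) < (#S + #T : ℕ) * μ := mul_pos (by exact_mod_cast hnonempty) hμpos
  push_cast at this
  linarith

/-- The number of members of `H` that contain `t`. -/
noncomputable def incidenceCount {V : Type*} (H : Finset (Sym2 V)) (t : V) : ℕ :=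
  #{e ∈ H | t ∈ e}

theorem incidenceCount_le_card {V : Type*} (H : Finset (Sym2 V)) (t : V) :
    incidenceCount H t ≤ #H :=
  Finset.card_filter_le _ _

theorem card_filter_mk_mem_le_incidenceCount {V : Type*} [Fintype V] (H : Finset (Sym2 V)) (t : V)
    [DecidablePred fun w => s(t, w) ∈ H] :
    #{w | s(t, w) ∈ H} ≤ incidenceCount H t :=
  Finset.card_le_card_of_injOn (fun w => s(t, w)) (fun w hw => by simpa using hw)
    fun _ _ _ _ h => Sym2.congr_right.1 h

theorem sum_incidenceCount_le {V : Type*} (H : Finset (Sym2 V)) (T : Finset V) :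
    ∑ t ∈ T, incidenceCount H t ≤ 2 * #H := by
  have h := Finset.sum_card_bipartiteAbove_eq_sum_card_bipartiteBelow
    (s := T) (t := H) (fun t e => t ∈ e)
  unfold Finset.bipartiteAbove Finset.bipartiteBelow at h
  unfold incidenceCount
  rw [h, mul_comm]
  refine Finset.sum_le_card_nsmul H _ 2 fun e _ => ?_
  have hsub : (T.filter fun t => t ∈ e) ⊆ e.toFinset := fun t ht =>
    Sym2.mem_toFinset.2 (Finset.mem_filter.1 ht).2
  refine (Finset.card_le_card hsub).trans ?_
  rw [Sym2.card_toFinset]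
  split_ifs <;> omega

theorem card_le_of_max_degree {V : Type*} [Fintype V] [DecidableEq V] (G : SimpleGraph V)
    [DecidableRel G.Adj] (I : Set V) (hI : ∀ u ∈ I, ∀ v ∈ I, ¬ G.Adj u v) {c : ℝ}
    (hc : c ≤ (Fintype.card V : ℝ) - 1)
    (hdeg : ∀ x y : V, x ≠ y → ¬ G.Adj x y → c ≤ ((max (G.degree x) (G.degree y) : ℕ) : ℝ)) :
    (#{x | x ∈ I} : ℝ) ≤ Fintype.card V - c := by
  have hbound : ∀ x ∈ I, (G.degree x : ℝ) ≤ Fintype.card V - #{x | x ∈ I} := by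
    intro x hx
    have hdisj : Disjoint (G.neighborFinset x) ({x | x ∈ I} : Finset V) :=
      Finset.disjoint_left.2 fun y hy hyI =>
        hI x hx y (by simpa using hyI) ((G.mem_neighborFinset x y).1 hy)
    have := Finset.card_le_univ (G.neighborFinset x ∪ ({x | x ∈ I} : Finset V))
    rw [Finset.card_union_of_disjoint hdisj, G.card_neighborFinset_eq_degree] at this
    have h2 : (G.degree x : ℝ) + #{x | x ∈ I} ≤ Fintype.card V := by exact_mod_cast this
    linarith
  rcases le_or_gt #{x | x ∈ I} 1 with h | h
  · have : (#{x | x ∈ I} : ℝ) ≤ 1 := by exact_mod_cast h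
    linarith
  · obtain ⟨x, hx, y, hy, hxy⟩ := Finset.one_lt_card.1 h
    have hx' : x ∈ I := by simpa using hx
    have hy' : y ∈ I := by simpa using hy
    have h1 := hdeg x y hxy (hI x hx' y hy')
    rw [Nat.cast_max] at h1
    rcases le_max_iff.1 h1 with h2 | h2
    · linarith [hbound x hx']
    · linarith [hbound y hy']

theorem degree_le_of_deleted {V : Type*} [Fintype V] [DecidableEq V] (G : SimpleGraph V)
    [DecidableRel G.Adj] (I : Set V) (H : Finset (Sym2 ↥Iᶜ)) (S : Finset ↥Iᶜ) (t : ↥Iᶜ) :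
    G.degree t ≤ #{x | x ∈ I} + #S +
      degreeOutside ((G.induce Iᶜ).deleteEdges ↑H) S t + incidenceCount H t := by
  have hsub : G.neighborFinset t ⊆ ({x | x ∈ I} : Finset V) ∪
      ((S ∪ ({w | ((G.induce Iᶜ).deleteEdges ↑H).Adj t w ∧ w ∉ S} : Finset ↥Iᶜ)) ∪
        ({w | s(t, w) ∈ H} : Finset ↥Iᶜ)).map (Function.Embedding.subtype _) := by
    intro y hy
    rw [SimpleGraph.mem_neighborFinset] at hy
    by_cases hyI : y ∈ I
    · exact Finset.mem_union_left _ (by simpa using hyI)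
    · refine Finset.mem_union_right _ (Finset.mem_map.2 ⟨⟨y, hyI⟩, ?_, rfl⟩)
      by_cases hyS : (⟨y, hyI⟩ : ↥Iᶜ) ∈ S
      · simp [hyS]
      · by_cases hyH : s(t, (⟨y, hyI⟩ : ↥Iᶜ)) ∈ H
        · simp [hyH]
        · simp [hyS, hyH, hy, SimpleGraph.deleteEdges_adj]
  have h1 := (Finset.card_le_card hsub).trans (Finset.card_union_le _ _)
  rw [Finset.card_map, G.card_neighborFinset_eq_degree] at h1
  have h2 := Finset.card_union_le
    (S ∪ ({w | ((G.induce Iᶜ).deleteEdges ↑H).Adj t w ∧ w ∉ S} : Finset ↥Iᶜ))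
    ({w | s(t, w) ∈ H} : Finset ↥Iᶜ)
  have h3 := Finset.card_union_le S
    ({w | ((G.induce Iᶜ).deleteEdges ↑H).Adj t w ∧ w ∉ S} : Finset ↥Iᶜ)
  rw [card_filter_adj_notMem] at h3
  have h4 := h2.trans (Nat.add_le_add h3 (card_filter_mk_mem_le_incidenceCount H t))
  omega

theorem card_clique_le_of_deleted {W : Type*} [Fintype W] (G : SimpleGraph W)
    (H : Finset (Sym2 W)) (S C : Finset W) (hSC : Disjoint S C) (t : W)
    (hC : ∀ w ∈ C, w ≠ t → G.Adj t w) :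
    #C ≤ degreeOutside (G.deleteEdges ↑H) S t + incidenceCount H t + 1 := by
  have hsub : C ⊆ insert t (({w | (G.deleteEdges ↑H).Adj t w ∧ w ∉ S} : Finset W) ∪
      ({w | s(t, w) ∈ H} : Finset W)) := by
    intro w hw
    by_cases hwt : w = t
    · simp [hwt]
    · have hwS : w ∉ S := fun h => Finset.disjoint_left.1 hSC h hw
      by_cases hwH : s(t, w) ∈ H
      · simp [hwH]
      · simp [hwS, hwH, hC w hw hwt, SimpleGraph.deleteEdges_adj]
  have h1 := (Finset.card_le_card hsub).trans (Finset.card_insert_le _ _)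
  have h2 := Finset.card_union_le ({w | (G.deleteEdges ↑H).Adj t w ∧ w ∉ S} : Finset W)
    ({w | s(t, w) ∈ H} : Finset W)
  rw [card_filter_adj_notMem] at h2
  have h3 := h2.trans (Nat.add_le_add_left (card_filter_mk_mem_le_incidenceCount H t) _)
  omega

theorem statement_5 {V : Type*} [Fintype V] [DecidableEq V]
    (G : SimpleGraph V) [DecidableRel G.Adj] (a b m Δ : ℕ) (g f : V → ℤ)
    (hba : a + Δ ≤ b) (ha : 2 ≤ a)
    (hmin : ∀ v : V, (G.degree v : ℝ) ≥
      ((a : ℝ) + Δ) * Fintype.card V / ((b : ℝ) + 2 * a + Δ)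
        + (b : ℝ) * ((b : ℝ) - Δ) / ((a : ℝ) + Δ) + m)
    (hn : (Fintype.card V : ℝ) >
      ((a : ℝ) + b + 2 * m - 1) * ((b : ℝ) + 2 * a + Δ) / ((a : ℝ) + Δ))
    (hgf : ∀ x : V, (a : ℤ) ≤ g x ∧ g x ≤ f x - (Δ : ℤ) ∧ f x - (Δ : ℤ) ≤ (b : ℤ) - (Δ : ℤ))
    (hdeg : ∀ x y : V, x ≠ y → ¬ G.Adj x y →
      ((max (G.degree x) (G.degree y) : ℕ) : ℝ) ≥
        ((a : ℝ) + b) * Fintype.card V / ((b : ℝ) + 2 * a + Δ)) :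
    FracIDDeleted G g f m := by
  obtain ⟨c, rfl⟩ := Nat.exists_eq_add_of_le hba
  set N : ℝ := (Fintype.card V : ℝ) / (((a + Δ + c : ℕ) : ℝ) + 2 * a + Δ) with hNdef
  have hp0 : (0 : ℝ) < (a : ℝ) + Δ := by
    have : (2 : ℝ) ≤ a := by exact_mod_cast ha
    positivity
  have hD : (0 : ℝ) < ((a + Δ + c : ℕ) : ℝ) + 2 * a + Δ := by push_cast; positivity
  have hcardV : (Fintype.card V : ℝ) = (2 * ((a : ℝ) + Δ) + (a + c)) * N := by
    rw [hNdef]; field_simp; push_cast; ring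
  have hN : ((a : ℝ) + Δ) + (a + c) + 2 * m - 1 < (a + Δ) * N := by
    rw [gt_iff_lt, div_lt_iff₀ hp0, hcardV] at hn
    refine lt_of_mul_lt_mul_right ?_ hD.le
    push_cast at hn ⊢
    linarith
  have hmin' : ∀ v : V, ((a : ℝ) + Δ) * N + (a + Δ + c) * (a + c) / (a + Δ) + m ≤ G.degree v := by
    intro v
    have := hmin v
    rw [mul_div_assoc] at this
    push_cast at this hNdef
    rw [← hNdef] at this
    convert this.le using 4
    ring
  have hdeg' : ∀ x y : V, x ≠ y → ¬ G.Adj x y →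
      (((a : ℝ) + Δ) + (a + c)) * N ≤ ((max (G.degree x) (G.degree y) : ℕ) : ℝ) := by
    intro x y hxy hadj
    refine le_of_eq_of_le ?_ (hdeg x y hxy hadj)
    rw [mul_div_assoc, ← hNdef]
    push_cast
    ring
  intro I hI H hH hHm
  have ha' : (2 : ℝ) ≤ a := by exact_mod_cast ha
  have hc0 : (0 : ℝ) ≤ c := by positivity
  have hm0 : (0 : ℝ) ≤ m := by positivity
  have hi : (#{x | x ∈ I} : ℝ) ≤ (a + Δ) * N := by
    have := card_le_of_max_degree G I hI
      (c := (((a : ℝ) + Δ) + (a + c)) * N) (by rw [hcardV]; nlinarith) hdeg'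
    rw [hcardV] at this
    linarith
  refine hasFracFactor_of_cut _ _ _ (fun x => by have := hgf x.1; omega) fun S T hST hlt => ?_
  have hcount : #S + #T + #{x | x ∈ I} ≤ Fintype.card V := by
    have hdisj : Disjoint ((S ∪ T).map (Function.Embedding.subtype _))
        ({x | x ∈ I} : Finset V) := by
      refine Finset.disjoint_left.2 fun x hx hxI => ?_
      obtain ⟨y, -, rfl⟩ := Finset.mem_map.1 hx
      exact y.2 (by simpa using hxI)
    have := Finset.card_le_univ
      ((S ∪ T).map (Function.Embedding.subtype _) ∪ ({x | x ∈ I} : Finset V))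
    rwa [Finset.card_union_of_disjoint hdisj, Finset.card_map,
      Finset.card_union_of_disjoint hST] at this
  have hdegree : ∀ t : ↥Iᶜ, (G.degree t.1 : ℝ) ≤ #{x | x ∈ I} + #S +
      degreeOutside ((G.induce Iᶜ).deleteEdges ↑H) S t + incidenceCount H t :=
    fun t => by exact_mod_cast degree_le_of_deleted G I H S t
  have hmain := card_mul_le_of_local_bounds T
    (fun t => degreeOutside ((G.induce Iᶜ).deleteEdges ↑H) S t)
    (fun t => incidenceCount H t)
    (fun t => (G.degree t.1 : ℝ) < (((a : ℝ) + Δ) + (a + c)) * N)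
    (a + Δ) (a + c) (a + Δ + c) m #S #{x | x ∈ I} N (by omega) (by omega) (by omega)
    (by push_cast; linarith) (by push_cast; linarith)
    (by
      push_cast
      rw [← hcardV]
      exact_mod_cast hcount)
    (fun t ht => by
      have h1 := hlt t ht
      have h2 := hgf t.1
      omega)
    (fun t _ => hHm ▸ incidenceCount_le_card H t)
    (hHm ▸ sum_incidenceCount_le H T)
    (fun t _ => by
      have h1 := hmin' t.1
      have h3 := h1.trans (hdegree t)
      have h4 : ((a : ℝ) + Δ + c) * (a + c) / (a + Δ) ≤
          #S + degreeOutside ((G.induce Iᶜ).deleteEdges ↑H) S t + incidenceCount H t - m := by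
        linarith
      rw [div_le_iff₀ hp0] at h4
      have h5 : ((a : ℝ) + Δ + c) * (a + c) + (a + Δ) * m ≤ (a + Δ) *
          (#S + degreeOutside ((G.induce Iᶜ).deleteEdges ↑H) S t + incidenceCount H t) := by
        linarith
      exact_mod_cast h5)
    (fun t _ hL => by
      have h3 := (not_lt.1 hL).trans (hdegree t)
      push_cast
      linarith)
    (fun t _ hL => by
      refine card_clique_le_of_deleted _ H S _ (hST.mono_right (Finset.filter_subset _ _)) t ?_
      intro w hw hwt
      by_contra hadj
      have h1 := hdeg' t.1 w.1 (fun h => hwt (Subtype.ext h.symm)) hadj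
      rw [Nat.cast_max] at h1
      exact absurd h1 (not_le.2 (max_lt hL (Finset.mem_filter.1 hw).2)))
  have h1 : ∑ t ∈ T, g t.1 ≤ #T * ((a : ℤ) + c) := by
    have := Finset.sum_le_card_nsmul T (fun t => g t.1) ((a : ℤ) + c) fun t _ => by
      have := hgf t.1
      omega
    simpa using this
  have h2 : #S * ((a : ℤ) + Δ) ≤ ∑ s ∈ S, f s.1 := by
    have := Finset.card_nsmul_le_sum S (fun t => f t.1) ((a : ℤ) + Δ) fun t _ => by
      have := hgf t.1
      omega
    simpa using this
  zify at hmain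
  linarith
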